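/- arXiv:1907.03303 — 3 statements merged into one kernel-verified Lean document; each statement's English description precedes it below -/
import Mathlib

section
/- Conditional expectation φ-mixing bound: Let 𝒢_1, 𝒢_2 be sub-σ-algebras of ℱ, and for i = 1, 2 let V_i be an ℝ^{d_i}-valued 𝒢_i-measurable random vector with distribution μ_i. Set d = d_1 + d_2, let κ be the distribution of (V_1, V_2), μ = μ_1 × μ_2 and ν = (κ + μ)/2. Let H ∈ L^∞(ℝ^d, ℬ(ℝ^d), ν). Then E[H(V_1,V_2) | 𝒢_1] exists, the function h(v) = E[H(v, V_2)] is defined for μ_1-almost every v ∈ ℝ^{d_1}, and P-almost surely |E[H(V_1,V_2) | 𝒢_1] − h(V_1)| ≤ 2·‖H‖_{L^∞(ℝ^d, ℬ(ℝ^d), ν)}·φ(𝒢_1, 𝒢_2). -/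
open MeasureTheory
open scoped ENNReal

noncomputable section

/-- The `φ`-dependence coefficient between two sub-σ-algebras `G` and `H`:
`φ(G,H) = sup { |P(Γ∩Δ)/P(Γ) − P(Δ)| : Γ ∈ G, Δ ∈ H, P(Γ) > 0 }`. -/
def phiDep {Ω : Type*} [MeasurableSpace Ω] (P : Measure Ω)
    (G H : MeasurableSpace Ω) : ℝ :=
  sSup {x : ℝ | ∃ A B : Set Ω, MeasurableSet[G] A ∧ MeasurableSet[H] B ∧ 0 < P A ∧
    x = |(P (A ∩ B)).toReal / (P A).toReal - (P B).toReal|}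

lemma aux_integral_diff {E : Type*} [MeasurableSpace E] (μ ν : Measure E)
    [IsProbabilityMeasure μ] [IsProbabilityMeasure ν] (c M : ℝ) (hM : 0 ≤ M)
    (h : ∀ B, MeasurableSet B → |μ.real B - ν.real B| ≤ c)
    (f : E → ℝ) (hf : Measurable f) (hb : ∀ x, |f x| ≤ M) :
    |∫ x, f x ∂μ - ∫ x, f x ∂ν| ≤ 2 * M * c := by
  have hint : ∀ (ρ : Measure E) [IsProbabilityMeasure ρ], Integrable f ρ := fun ρ _ =>
    Integrable.of_bound hf.aestronglyMeasurable M (Filter.Eventually.of_forall hb)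
  have key : ∀ (ρ : Measure E) [IsProbabilityMeasure ρ],
      ∫ x, f x ∂ρ + M = ∫ t in Set.Ioc 0 (2 * M), ρ.real {a | t ≤ f a + M} := by
    intro ρ _
    rw [← Integrable.integral_eq_integral_Ioc_meas_le (f := fun a => f a + M)
      ((hint ρ).add (integrable_const M))
      (Filter.Eventually.of_forall fun x => by
        have := abs_le.1 (hb x); simp only [Pi.zero_apply]; linarith)
      (Filter.Eventually.of_forall fun x => by
        have := abs_le.1 (hb x); simp only; linarith)]
    rw [integral_add (hint ρ) (integrable_const M)]
    simp
  have hi : ∀ (ρ : Measure E) [IsProbabilityMeasure ρ],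
      IntegrableOn (fun t => ρ.real {a | t ≤ f a + M}) (Set.Ioc 0 (2 * M)) := by
    intro ρ _
    have hanti : Antitone (fun t => ρ.real {a | t ≤ f a + M}) := fun s t hst =>
      measureReal_mono (fun a (ha : t ≤ f a + M) => (hst.trans ha : s ≤ f a + M))
    refine Integrable.of_bound hanti.measurable.aestronglyMeasurable 1
      (Filter.Eventually.of_forall fun t => ?_)
    rw [Real.norm_eq_abs, abs_of_nonneg measureReal_nonneg]
    exact measureReal_le_one
  have e : ∫ x, f x ∂μ - ∫ x, f x ∂ν
      = ∫ t in Set.Ioc 0 (2 * M), (μ.real {a | t ≤ f a + M} - ν.real {a | t ≤ f a + M}) := by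
    rw [integral_sub (hi μ) (hi ν), ← key μ, ← key ν]; ring
  rw [e, ← Real.norm_eq_abs]
  refine (norm_setIntegral_le_of_norm_le_const (C := c) measure_Ioc_lt_top fun t _ => ?_).trans ?_
  · exact h _ (measurableSet_le measurable_const (hf.add_const M))
  · rw [Real.volume_real_Ioc_of_le (by linarith)]
    apply le_of_eq; ring

lemma aux_approx {E : Type*} [m : MeasurableSpace E] (μ ν : Measure E)
    [IsProbabilityMeasure μ] [IsProbabilityMeasure ν] (c : ℝ) (𝒜 : Set (Set E))
    (h𝒜 : IsSetAlgebra 𝒜) (hgen : m = MeasurableSpace.generateFrom 𝒜)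
    (h : ∀ B ∈ 𝒜, |μ.real B - ν.real B| ≤ c) (B : Set E) (hB : MeasurableSet B) :
    |μ.real B - ν.real B| ≤ c := by
  have hd := Measure.MeasureDense.of_generateFrom_isSetAlgebra_finite (μ + ν) h𝒜 hgen
  refine le_of_forall_pos_le_add fun ε hε => ?_
  obtain ⟨t, ht, hlt⟩ := hd.approx B hB (by finiteness) ε hε
  have htm := hd.measurable t ht
  have h1 := abs_measureReal_sub_le_measureReal_symmDiff (μ := μ) hB.nullMeasurableSet
    htm.nullMeasurableSet
  have h2 := abs_measureReal_sub_le_measureReal_symmDiff (μ := ν) hB.nullMeasurableSet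
    htm.nullMeasurableSet
  have h3 : μ.real (symmDiff B t) + ν.real (symmDiff B t) ≤ ε := by
    rw [← measureReal_add_apply]
    exact ENNReal.toReal_le_of_le_ofReal hε.le hlt.le
  have h4 := h t ht
  rw [abs_le] at *
  constructor <;> linarith [h1.1, h1.2, h2.1, h2.2, h4.1, h4.2]

lemma aux_kernel {Ω β E : Type*} [MeasurableSpace Ω] [MeasurableSpace β]
    [MeasurableSpace E] [StandardBorelSpace E] [Nonempty E]
    (P : Measure Ω) [IsProbabilityMeasure P] (X : Ω → β) (Y : Ω → E)
    (hX : Measurable X) (hY : Measurable Y) (c : ℝ)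
    (hc : ∀ A B, MeasurableSet A → MeasurableSet B →
      |P.real (X ⁻¹' A ∩ Y ⁻¹' B) - P.real (X ⁻¹' A) * P.real (Y ⁻¹' B)| ≤ c * P.real (X ⁻¹' A))
    (B : Set E) (hB : MeasurableSet B) :
    ∀ᵐ b ∂(P.map X), |(ProbabilityTheory.condDistrib Y X P b).real B - (P.map Y).real B| ≤ c := by
  have : IsProbabilityMeasure (P.map X) := Measure.isProbabilityMeasure_map hX.aemeasurable
  set g : β → ℝ := fun b => (ProbabilityTheory.condDistrib Y X P b).real B with hg
  have hgm : Measurable g := (ProbabilityTheory.Kernel.measurable_coe _ hB).ennreal_toReal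
  have hgi : Integrable g (P.map X) := by
    refine Integrable.of_bound hgm.aestronglyMeasurable 1 (Filter.Eventually.of_forall fun t => ?_)
    rw [Real.norm_eq_abs, abs_of_nonneg measureReal_nonneg]
    exact measureReal_le_one
  have hset : ∀ A, MeasurableSet A → ∫ b in A, g b ∂(P.map X) = P.real (X ⁻¹' A ∩ Y ⁻¹' B) := by
    intro A hA
    rw [hg]
    simp only [measureReal_def]
    rw [integral_toReal (ProbabilityTheory.Kernel.measurable_coe _ hB).aemeasurable
      (Filter.Eventually.of_forall fun b => by finiteness)]
    rw [← ProbabilityTheory.setLIntegral_preimage_condDistrib hX hY.aemeasurable hB hA,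
      setLIntegral_map hA (ProbabilityTheory.Kernel.measurable_coe _ hB) hX]
  have hYB : (P.map Y).real B = P.real (Y ⁻¹' B) := by
    rw [measureReal_def, measureReal_def, Measure.map_apply hY hB]
  have hXA : ∀ A, MeasurableSet A → (P.map X).real A = P.real (X ⁻¹' A) := by
    intro A hA
    rw [measureReal_def, measureReal_def, Measure.map_apply hX hA]
  have u : g ≤ᵐ[P.map X] fun _ => (P.map Y).real B + c := by
    refine ae_le_of_forall_setIntegral_le hgi (integrable_const _) fun A hA _ => ?_
    rw [hset A hA, setIntegral_const, hXA A hA, hYB, smul_eq_mul]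
    have := (abs_le.1 (hc A B hA hB)).2
    linarith
  have l : (fun _ => (P.map Y).real B - c) ≤ᵐ[P.map X] g := by
    refine ae_le_of_forall_setIntegral_le (integrable_const _) hgi fun A hA _ => ?_
    rw [hset A hA, setIntegral_const, hXA A hA, hYB, smul_eq_mul]
    have := (abs_le.1 (hc A B hA hB)).1
    linarith
  filter_upwards [u, l] with b hu hl
  rw [abs_le]
  constructor <;> linarith

lemma aux_core {Ω β E : Type*} [MeasurableSpace Ω] [mβ : MeasurableSpace β]
    [MeasurableSpace E] [StandardBorelSpace E] [Nonempty E]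
    (P : Measure Ω) [IsProbabilityMeasure P] (X : Ω → β) (Y : Ω → E)
    (hX : Measurable X) (hY : Measurable Y) (c M : ℝ) (hM : 0 ≤ M)
    (hc : ∀ A B, MeasurableSet A → MeasurableSet B →
      |P.real (X ⁻¹' A ∩ Y ⁻¹' B) - P.real (X ⁻¹' A) * P.real (Y ⁻¹' B)| ≤ c * P.real (X ⁻¹' A))
    (f : β × E → ℝ) (hf : Measurable f) (hb : ∀ x, |f x| ≤ M) :
    ∀ᵐ ω ∂P, |(P[fun ω' => f (X ω', Y ω')|mβ.comap X]) ω - ∫ ω', f (X ω, Y ω') ∂P|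
      ≤ 2 * M * c := by
  have : IsProbabilityMeasure (P.map Y) := Measure.isProbabilityMeasure_map hY.aemeasurable
  set 𝒜 := generateSetAlgebra (MeasurableSpace.countableGeneratingSet E) with h𝒜
  have hcount : 𝒜.Countable :=
    countable_generateSetAlgebra MeasurableSpace.countable_countableGeneratingSet
  have hgen : ‹MeasurableSpace E› = MeasurableSpace.generateFrom 𝒜 := by
    rw [h𝒜, generateFrom_generateSetAlgebra_eq,
      MeasurableSpace.generateFrom_countableGeneratingSet]
  have hmeas : ∀ B ∈ 𝒜, MeasurableSet B := fun B hB => by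
    rw [hgen]; exact MeasurableSpace.measurableSet_generateFrom hB
  have h1 : ∀ᵐ b ∂(P.map X), ∀ B ∈ 𝒜,
      |(ProbabilityTheory.condDistrib Y X P b).real B - (P.map Y).real B| ≤ c :=
    (ae_ball_iff hcount).2 fun B hB => aux_kernel P X Y hX hY c hc B (hmeas B hB)
  have hint : Integrable (fun a => f (X a, Y a)) P :=
    Integrable.of_bound (hf.comp (hX.prodMk hY)).aestronglyMeasurable M
      (Filter.Eventually.of_forall fun _ => hb _)
  filter_upwards [ae_of_ae_map hX.aemeasurable h1,
    ProbabilityTheory.condExp_prod_ae_eq_integral_condDistrib hX hY.aemeasurable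
      hf.stronglyMeasurable hint] with ω hω hω2
  have hfm : Measurable fun y => f (X ω, y) := hf.comp measurable_prodMk_left
  rw [hω2, ← integral_map (φ := Y) (f := fun y => f (X ω, y)) hY.aemeasurable
    hfm.aestronglyMeasurable]
  exact aux_integral_diff _ _ c M hM
    (aux_approx _ _ c 𝒜 isSetAlgebra_generateSetAlgebra hgen hω) _ hfm fun _ => hb _

lemma aux_phi {Ω : Type*} (G₁ G₂ : MeasurableSpace Ω)
    [m0 : MeasurableSpace Ω] (P : Measure Ω) [IsProbabilityMeasure P]
    (A B : Set Ω) (hA : MeasurableSet[G₁] A) (hB : MeasurableSet[G₂] B) :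
    |P.real (A ∩ B) - P.real A * P.real B| ≤ phiDep P G₁ G₂ * P.real A := by
  by_cases h0 : P A = 0
  · have h1 : P (A ∩ B) = 0 := measure_mono_null Set.inter_subset_left h0
    simp [measureReal_def, h0, h1]
  have hpos : 0 < P.real A := ENNReal.toReal_pos h0 (by finiteness)
  have hle : |P.real (A ∩ B) / P.real A - P.real B| ≤ phiDep P G₁ G₂ := by
    refine le_csSup ⟨1, ?_⟩ ⟨A, B, hA, hB, pos_iff_ne_zero.2 h0, rfl⟩
    rintro x ⟨A', B', -, -, -, rfl⟩
    have h1 : P.real (A' ∩ B') / P.real A' ≤ 1 :=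
      div_le_one_of_le₀ (measureReal_mono Set.inter_subset_left) measureReal_nonneg
    have h2 : 0 ≤ P.real (A' ∩ B') / P.real A' := div_nonneg measureReal_nonneg measureReal_nonneg
    have h3 : P.real B' ≤ 1 := measureReal_le_one
    have h4 : 0 ≤ P.real B' := measureReal_nonneg
    simp only [measureReal_def] at h1 h2 h3 h4
    rw [abs_le]; constructor <;> linarith
  have e : P.real (A ∩ B) - P.real A * P.real B
      = (P.real (A ∩ B) / P.real A - P.real B) * P.real A := by
    field_simp
  rw [e, abs_mul, abs_of_pos hpos]
  exact mul_le_mul_of_nonneg_right hle hpos.le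

/-- Conditional expectation φ-mixing bound (Lemma 4.3 of the paper). -/
theorem condexp_phi_mixing_bound
    {Ω : Type*} (G₁ G₂ : MeasurableSpace Ω)
    [m0 : MeasurableSpace Ω] (P : Measure Ω) [IsProbabilityMeasure P]
    (hG₁ : G₁ ≤ m0) (hG₂ : G₂ ≤ m0)
    (d₁ d₂ : ℕ) (V₁ : Ω → (Fin d₁ → ℝ)) (V₂ : Ω → (Fin d₂ → ℝ))
    (hV₁ : Measurable[G₁] V₁) (hV₂ : Measurable[G₂] V₂)
    (H : (Fin d₁ → ℝ) × (Fin d₂ → ℝ) → ℝ) (hHmeas : Measurable H)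
    (hHbd : eLpNorm H ⊤ ((2 : ℝ≥0∞)⁻¹ • (Measure.map (fun ω => (V₁ ω, V₂ ω)) P
        + (Measure.map V₁ P).prod (Measure.map V₂ P))) < ⊤) :
    Integrable (fun ω => H (V₁ ω, V₂ ω)) P ∧
    (∀ᵐ v ∂(Measure.map V₁ P), Integrable (fun ω => H (v, V₂ ω)) P) ∧
    ∀ᵐ ω ∂P,
      |(P[fun ω' => H (V₁ ω', V₂ ω')|G₁]) ω - ∫ ω', H (V₁ ω, V₂ ω') ∂P|
        ≤ 2 * (eLpNorm H ⊤ ((2 : ℝ≥0∞)⁻¹ • (Measure.map (fun ω => (V₁ ω, V₂ ω)) P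
            + (Measure.map V₁ P).prod (Measure.map V₂ P)))).toReal
          * phiDep P G₁ G₂ := by
  set ν := (2 : ℝ≥0∞)⁻¹ • (Measure.map (fun ω => (V₁ ω, V₂ ω)) P
        + (Measure.map V₁ P).prod (Measure.map V₂ P)) with hν
  set M := (eLpNorm H ⊤ ν).toReal with hM
  have hV₁' : Measurable V₁ := hV₁.mono hG₁ le_rfl
  have hV₂' : Measurable V₂ := hV₂.mono hG₂ le_rfl
  have hp1 : IsProbabilityMeasure (P.map V₁) := Measure.isProbabilityMeasure_map hV₁'.aemeasurable
  have hp2 : IsProbabilityMeasure (P.map V₂) := Measure.isProbabilityMeasure_map hV₂'.aemeasurable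
  have hM0 : 0 ≤ M := ENNReal.toReal_nonneg
  have hae : ∀ᵐ x ∂ν, |H x| ≤ M := by
    have := ae_le_eLpNormEssSup (f := H) (μ := ν)
    rw [← eLpNorm_exponent_top] at this
    filter_upwards [this] with x hx
    have := ENNReal.toReal_mono hHbd.ne hx
    rwa [toReal_enorm, Real.norm_eq_abs] at this
  have hae' : ∀ᵐ x ∂(Measure.map (fun ω => (V₁ ω, V₂ ω)) P
        + (Measure.map V₁ P).prod (Measure.map V₂ P)), |H x| ≤ M := by
    exact (Measure.absolutelyContinuous_smul (by simp)).ae_le hae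
  rw [ae_add_measure_iff] at hae'
  obtain ⟨hk, hm⟩ := hae'
  have hk' : ∀ᵐ ω ∂P, |H (V₁ ω, V₂ ω)| ≤ M :=
    ae_of_ae_map (hV₁'.prodMk hV₂').aemeasurable hk
  have hm' : ∀ᵐ v ∂(P.map V₁), ∀ᵐ ω ∂P, |H (v, V₂ ω)| ≤ M := by
    filter_upwards [Measure.ae_ae_of_ae_prod hm] with v hv
    exact ae_of_ae_map hV₂'.aemeasurable hv
  refine ⟨Integrable.of_bound (hHmeas.comp (hV₁'.prodMk hV₂')).aestronglyMeasurable M hk', ?_, ?_⟩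
  · filter_upwards [hm'] with v hv
    exact Integrable.of_bound
      (hHmeas.comp (measurable_prodMk_left.comp hV₂')).aestronglyMeasurable M hv
  -- truncate `H`
  set H' : (Fin d₁ → ℝ) × (Fin d₂ → ℝ) → ℝ := fun x => max (-M) (min (H x) M) with hH'
  have hH'm : Measurable H' := measurable_const.max (hHmeas.min measurable_const)
  have hH'b : ∀ x, |H' x| ≤ M := fun x =>
    abs_le.2 ⟨le_max_left _ _, max_le (by linarith) (min_le_right _ _)⟩
  have hHH' : ∀ x, |H x| ≤ M → H' x = H x := fun x hx => by
    rw [hH']; simp only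
    rw [min_eq_left (abs_le.1 hx).2, max_eq_right (abs_le.1 hx).1]
  have hcomap : G₁.comap (id : Ω → Ω) = G₁ := MeasurableSpace.comap_id
  have hf : @Measurable _ _ (@Prod.instMeasurableSpace _ _ G₁ _) _
      (fun p : Ω × (Fin d₂ → ℝ) => H' (V₁ p.1, p.2)) := by
    refine hH'm.comp ?_
    exact (hV₁.comp (@measurable_fst _ _ G₁ _)).prodMk (@measurable_snd _ _ G₁ _)
  have core := @aux_core Ω Ω (Fin d₂ → ℝ) m0 G₁ _ _ _ P _ id V₂ (measurable_id'' hG₁) hV₂'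
    (phiDep P G₁ G₂) M hM0
    (fun A B hA hB => aux_phi G₁ G₂ P A (V₂ ⁻¹' B) hA (hV₂ hB))
    (fun p => H' (V₁ p.1, p.2)) hf (fun _ => hH'b _)
  rw [hcomap] at core
  have hcong : P[fun ω' => H (V₁ ω', V₂ ω')|G₁] =ᵐ[P] P[fun ω' => H' (V₁ ω', V₂ ω')|G₁] := by
    refine condExp_congr_ae ?_
    filter_upwards [hk'] with ω hω
    exact (hHH' _ hω).symm
  filter_upwards [core, hcong, ae_of_ae_map hV₁'.aemeasurable hm'] with ω h1 h2 h3
  have h4 : ∫ ω', H (V₁ ω, V₂ ω') ∂P = ∫ ω', H' (V₁ ω, V₂ ω') ∂P := by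
    refine integral_congr_ae ?_
    filter_upwards [h3] with ω' h
    exact (hHH' _ h).symm
  rw [h2, h4]
  exact h1
end
end

section
/- Block decorrelation estimate: Let U_1,…,U_k be random vectors, U_i being ℝ^{d_i}-valued and ℱ_{m_i,n_i}-measurable, where n_{i−1} < m_i ≤ n_i < m_{i+1} for i = 1,…,k, n_0 = −∞, m_{k+1} = ∞. Let {𝒞_1,…,𝒞_s} be a partition of {1,…,k}, for each j let μ_j be the joint law of the block (U_i)_{i∈𝒞_j}, and let λ be the law on ℝ^{d_1+…+d_k} obtained by making the blocks independent, i.e., the image of μ_1 ⊗ … ⊗ μ_s under the coordinate-reassembling map. Then for every bounded Borel function H : ℝ^{d_1+…+d_k} → ℝ: |E[H(U_1,…,U_k)] − ∫ H dλ| ≤ 4·(sup|H|)·Σ_{i=2}^k φ(m_i − n_{i−1}). In particular, when s = 2, α(σ{(U_i)_{i∈𝒞_1}}, σ{(U_i)_{i∈𝒞_2}}) ≤ 4·Σ_{i=2}^k φ(m_i − n_{i−1}), where α(𝒢,ℋ) = sup{ |P(Γ∩Δ) − P(Γ)P(Δ)| : Γ ∈ 𝒢, Δ ∈ ℋ }.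 -/
open MeasureTheory
open scoped ENNReal

noncomputable section

/-- The `α`-dependence coefficient between two sub-σ-algebras:
`α(G,H) = sup { |P(Γ∩Δ) − P(Γ)P(Δ)| : Γ ∈ G, Δ ∈ H }`. -/
def alphaDep {Ω : Type*} [MeasurableSpace Ω] (P : Measure Ω)
    (G H : MeasurableSpace Ω) : ℝ :=
  sSup {x : ℝ | ∃ A B : Set Ω, MeasurableSet[G] A ∧ MeasurableSet[H] B ∧
    x = |(P (A ∩ B)).toReal - (P A).toReal * (P B).toReal|}


open scoped symmDiff in
theorem bd_rect {α β : Type*} [MeasurableSpace α] [MeasurableSpace β]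
    (ρ : Measure (α × β)) (μ : Measure α) (ν : Measure β)
    [IsProbabilityMeasure ρ] [IsProbabilityMeasure μ] [IsProbabilityMeasure ν] (φ : ℝ)
    (h : ∀ A B, MeasurableSet A → MeasurableSet B →
      |ρ.real (A ×ˢ B) - μ.real A * ν.real B| ≤ φ * ν.real B)
    (S : Set (α × β)) (hS : MeasurableSet S) :
    |ρ.real S - (μ.prod ν).real S| ≤ φ := by
  classical
  let 𝒜 : Set (Set (α × β)) := {S | ∃ (ι : Type) (_ : Fintype ι) (f : β → ι) (B : ι → Set α),
    (∀ i, MeasurableSet (f ⁻¹' {i})) ∧ (∀ i, MeasurableSet (B i)) ∧ S = {p | p.1 ∈ B (f p.2)}}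
  have hdec : ∀ {ι : Type} (f : β → ι) (B : ι → Set α),
      {p : α × β | p.1 ∈ B (f p.2)} = ⋃ i, B i ×ˢ (f ⁻¹' {i}) := by
    intro ι f B; ext p; simp
  have h𝒜m : ∀ T ∈ 𝒜, MeasurableSet T := by
    rintro T ⟨ι, _, f, B, hf, hB, rfl⟩
    rw [hdec]
    exact MeasurableSet.iUnion fun i => (hB i).prod (hf i)
  have h𝒜b : ∀ T ∈ 𝒜, |ρ.real T - (μ.prod ν).real T| ≤ φ := by
    rintro T ⟨ι, _, f, B, hf, hB, rfl⟩
    rw [hdec]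
    have hd : Pairwise (Function.onFun Disjoint fun i => B i ×ˢ (f ⁻¹' {i})) := by
      intro i j hij
      rw [Function.onFun, Set.disjoint_left]
      rintro p hp hq
      simp only [Set.mem_prod, Set.mem_preimage, Set.mem_singleton_iff] at hp hq
      exact hij (hp.2.symm.trans hq.2)
    have hd2 : Pairwise (Function.onFun Disjoint fun i => (f ⁻¹' {i})) := by
      intro i j hij
      rw [Function.onFun, Set.disjoint_left]
      rintro p hp hq
      simp only [Set.mem_preimage, Set.mem_singleton_iff] at hp hq
      exact hij (hp.symm.trans hq)
    rw [measureReal_iUnion_fintype hd (fun i => (hB i).prod (hf i)),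
      measureReal_iUnion_fintype hd (fun i => (hB i).prod (hf i)), ← Finset.sum_sub_distrib]
    have h1 : ∑ i, ν.real (f ⁻¹' {i}) = 1 := by
      rw [← measureReal_iUnion_fintype hd2 hf]
      have : (⋃ i, f ⁻¹' {i}) = Set.univ := by ext; simp
      rw [this]; simp
    calc _ ≤ ∑ i, |ρ.real (B i ×ˢ (f ⁻¹' {i})) - (μ.prod ν).real (B i ×ˢ (f ⁻¹' {i}))| :=
          Finset.abs_sum_le_sum_abs _ _
      _ ≤ ∑ i, φ * ν.real (f ⁻¹' {i}) := by
          apply Finset.sum_le_sum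
          intro i _
          rw [measureReal_prod_prod]
          exact h _ _ (hB i) (hf i)
      _ = φ := by rw [← Finset.mul_sum, h1, mul_one]
  have hring : IsSetRing 𝒜 := by
    have hpair : ∀ {ι κ : Type} (f : β → ι) (g : β → κ), (∀ i, MeasurableSet (f ⁻¹' {i})) →
        (∀ i, MeasurableSet (g ⁻¹' {i})) →
        ∀ i : ι × κ, MeasurableSet ((fun x => (f x, g x)) ⁻¹' {i}) := by
      intro ι κ f g hf hg i
      have : ((fun x => (f x, g x)) ⁻¹' {i}) = f ⁻¹' {i.1} ∩ g ⁻¹' {i.2} := by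
        ext x; simp [Prod.ext_iff]
      rw [this]; exact (hf _).inter (hg _)
    refine ⟨⟨Unit, inferInstance, fun _ => (), fun _ => ∅, by simp, by simp, by simp⟩, ?_, ?_⟩
    · rintro _ _ ⟨ι, _, f, B, hf, hB, rfl⟩ ⟨κ, _, g, D, hg, hD, rfl⟩
      exact ⟨ι × κ, inferInstance, fun x => (f x, g x), fun i => B i.1 ∪ D i.2, hpair f g hf hg,
        fun i => (hB _).union (hD _), by ext; simp⟩
    · rintro _ _ ⟨ι, _, f, B, hf, hB, rfl⟩ ⟨κ, _, g, D, hg, hD, rfl⟩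
      exact ⟨ι × κ, inferInstance, fun x => (f x, g x), fun i => B i.1 \ D i.2, hpair f g hf hg,
        fun i => (hB _).diff (hD _), by ext; simp⟩
  have hrectmem : ∀ A B, MeasurableSet A → MeasurableSet B → A ×ˢ B ∈ 𝒜 := by
    intro A B hA hB
    refine ⟨Prop, inferInstance, fun x => x ∈ B, fun q => {x | x ∈ A ∧ q}, ?_, ?_, ?_⟩
    · intro q
      by_cases hq : q
      · convert hB using 1; ext x; simp [hq]
      · convert hB.compl using 1; ext x; simp [hq]
    · intro q
      by_cases hq : q <;> simp [hq, hA]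
    · ext; simp
  have hgen : (inferInstance : MeasurableSpace (α × β)) = MeasurableSpace.generateFrom 𝒜 := by
    apply le_antisymm
    · change Prod.instMeasurableSpace ≤ _
      rw [← generateFrom_prod]
      apply MeasurableSpace.generateFrom_mono
      rintro _ ⟨A, hA, B, hB, rfl⟩
      exact hrectmem A B hA hB
    · exact MeasurableSpace.generateFrom_le h𝒜m
  apply le_of_forall_pos_le_add
  intro ε hε
  obtain ⟨T, hT, hTS⟩ := exists_measure_symmDiff_lt_of_generateFrom_isSetRing
    (μ := ρ + μ.prod ν) hring
    ⟨{Set.univ}, by simp, by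
      rw [Set.singleton_subset_iff, ← Set.univ_prod_univ]
      exact hrectmem _ _ .univ .univ, by simp⟩ hgen hS
    (ε := ENNReal.ofReal ε) (by simpa using hε)
  have hTS' : ρ.real (T ∆ S) + (μ.prod ν).real (T ∆ S) < ε := by
    rw [Measure.real, Measure.real, ← ENNReal.toReal_add (by finiteness) (by finiteness)]
    rw [Measure.add_apply] at hTS
    exact (ENNReal.lt_ofReal_iff_toReal_lt (by finiteness)).1 hTS
  have h1 := abs_measureReal_sub_le_measureReal_symmDiff (μ := ρ)
    (h𝒜m T hT).nullMeasurableSet hS.nullMeasurableSet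
  have h2 := abs_measureReal_sub_le_measureReal_symmDiff (μ := μ.prod ν)
    (h𝒜m T hT).nullMeasurableSet hS.nullMeasurableSet
  have h3 := h𝒜b T hT
  rw [abs_le] at *
  constructor <;> linarith

theorem bd_integral {α : Type*} [MeasurableSpace α] (μ ν : Measure α)
    [IsProbabilityMeasure μ] [IsProbabilityMeasure ν] (ε C : ℝ) (hC0 : 0 ≤ C)
    (h : ∀ S, MeasurableSet S → |μ.real S - ν.real S| ≤ ε)
    (H : α → ℝ) (hH : Measurable H) (hC : ∀ x, |H x| ≤ C) :
    |∫ x, H x ∂μ - ∫ x, H x ∂ν| ≤ 2 * C * ε := by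
  have key : ∀ (κ : Measure α) [IsProbabilityMeasure κ],
      Integrable H κ ∧ ∫ x, H x ∂κ = (∫ t in Set.Ioc 0 (2 * C), κ.real {a | t ≤ H a + C}) - C := by
    intro κ _
    have hi : Integrable H κ := Integrable.of_bound hH.aestronglyMeasurable C
      (ae_of_all _ fun x => by simpa using hC x)
    refine ⟨hi, ?_⟩
    have hi2 : Integrable (fun x => H x + C) κ := hi.add (integrable_const C)
    rw [← hi2.integral_eq_integral_Ioc_meas_le (M := 2 * C)
      (ae_of_all _ fun x => by have := abs_le.1 (hC x); simp; linarith)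
      (ae_of_all _ fun x => by have := abs_le.1 (hC x); simp; linarith),
      integral_add hi (integrable_const C)]
    simp
  have hm : ∀ (κ : Measure α) [IsProbabilityMeasure κ],
      IntegrableOn (fun t => κ.real {a | t ≤ H a + C}) (Set.Ioc 0 (2 * C)) := by
    intro κ _
    apply Measure.integrableOn_of_bounded (M := 1) measure_Ioc_lt_top.ne
    · apply Measurable.aestronglyMeasurable
      apply Antitone.measurable
      intro a b hab
      exact measureReal_mono (fun x hx => le_trans hab hx)
    · refine ae_of_all _ fun t => ?_
      rw [Real.norm_of_nonneg measureReal_nonneg]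
      exact measureReal_le_one
  rw [(key μ).2, (key ν).2, sub_sub_sub_cancel_right, ← integral_sub (hm μ) (hm ν)]
  have := norm_setIntegral_le_of_norm_le_const (μ := volume) (s := Set.Ioc 0 (2 * C))
    (f := fun t => μ.real {a | t ≤ H a + C} - ν.real {a | t ≤ H a + C}) (C := ε) measure_Ioc_lt_top
    (fun t _ => h _ (measurableSet_le measurable_const (hH.add_const C)))
  rw [Real.norm_eq_abs] at this
  refine this.trans (le_of_eq ?_)
  rw [Real.volume_real_Ioc_of_le (by linarith)]
  ring

theorem bd_prod_right {α β : Type*} [MeasurableSpace α] [MeasurableSpace β]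
    (μ : Measure α) (ν ν' : Measure β)
    [IsProbabilityMeasure μ] [IsProbabilityMeasure ν] [IsProbabilityMeasure ν'] (ε : ℝ)
    (h : ∀ S, MeasurableSet S → |ν.real S - ν'.real S| ≤ ε)
    (S : Set (α × β)) (hS : MeasurableSet S) :
    |(μ.prod ν).real S - (μ.prod ν').real S| ≤ ε := by
  have hi : ∀ (κ : Measure β) [IsProbabilityMeasure κ],
      Integrable (fun x => κ.real (Prod.mk x ⁻¹' S)) μ := by
    intro κ _
    refine Integrable.of_bound (C := 1) ?_ (ae_of_all _ fun x => ?_)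
    · exact (measurable_measure_prodMk_left hS).ennreal_toReal.aestronglyMeasurable
    · rw [Real.norm_of_nonneg measureReal_nonneg]
      exact measureReal_le_one
  have hr : ∀ (κ : Measure β) [IsProbabilityMeasure κ],
      (μ.prod κ).real S = ∫ x, κ.real (Prod.mk x ⁻¹' S) ∂μ := by
    intro κ _
    rw [Measure.real, Measure.prod_apply hS, ← integral_toReal]
    · rfl
    · exact (measurable_measure_prodMk_left hS).aemeasurable
    · exact ae_of_all _ fun x => by finiteness
  rw [hr, hr, ← integral_sub (hi ν) (hi ν'), ← Real.norm_eq_abs]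
  refine (norm_integral_le_of_norm_le_const (C := ε) (ae_of_all _ fun x => ?_)).trans ?_
  · exact h _ (measurable_prodMk_left hS)
  · simp

theorem bd_chain {Ω : Type*} [m0 : MeasurableSpace Ω] (Q : Measure Ω) [IsProbabilityMeasure Q] :
    ∀ (k : ℕ) (E : Fin k → Type) [∀ i, MeasurableSpace (E i)] (V : ∀ i, Ω → E i)
    (_ : ∀ i, Measurable (V i)) (G : Fin k → MeasurableSpace Ω)
    (_ : ∀ i j, j < i → Measurable[G i] (V j)) (φ : Fin k → ℝ)
    (_ : ∀ i A B, MeasurableSet[G i] A → MeasurableSet B →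
      |Q.real (A ∩ V i ⁻¹' B) - Q.real A * Q.real (V i ⁻¹' B)| ≤ φ i * Q.real A)
    (S : Set (∀ i, E i)) (_ : MeasurableSet S),
    |(Q.map (fun ω i => V i ω)).real S - (Measure.pi fun i => Q.map (V i)).real S| ≤ ∑ i, φ i := by
  intro k
  induction k with
  | zero =>
    intro E _ V hV G hG φ h S hS
    have hP : ∀ i, IsProbabilityMeasure (Q.map (V i)) := fun i =>
      Measure.isProbabilityMeasure_map (hV i).aemeasurable
    have : IsProbabilityMeasure (Q.map (fun ω i => V i ω)) :=
      Measure.isProbabilityMeasure_map (measurable_pi_lambda _ hV).aemeasurable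
    rcases Set.eq_empty_or_nonempty S with rfl | hne
    · simp
    · have : S = Set.univ := by
        obtain ⟨x, hx⟩ := hne
        ext y; rw [Subsingleton.elim y x]; simp [hx]
      simp [this]
  | succ k ih =>
    intro E _ V hV G hG φ h S hS
    have hP : ∀ i, IsProbabilityMeasure (Q.map (V i)) := fun i =>
      Measure.isProbabilityMeasure_map (hV i).aemeasurable
    let l := Fin.last k
    let W : Ω → ∀ j, E (l.succAbove j) := fun ω j => V (l.succAbove j) ω
    have hW : Measurable W := measurable_pi_lambda _ fun j => hV _
    have : IsProbabilityMeasure (Q.map W) :=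
      Measure.isProbabilityMeasure_map hW.aemeasurable
    have hlt : ∀ j, l.succAbove j < l := fun j => by
      simp only [l, Fin.succAbove_last]; exact Fin.castSucc_lt_last j
    have hWG : Measurable[G l] W := by
      apply @measurable_pi_lambda _ _ _ (G l)
      intro j
      exact hG l _ (hlt j)
    have hVW : Measurable fun ω => (V l ω, W ω) := (hV l).prodMk hW
    have : IsProbabilityMeasure (Q.map fun ω => (V l ω, W ω)) :=
      Measure.isProbabilityMeasure_map hVW.aemeasurable
    let e := MeasurableEquiv.piFinSuccAbove E l
    have hS' : MeasurableSet (e.symm ⁻¹' S) := e.symm.measurable hS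
    have e1 : (Q.map (fun ω i => V i ω)).real S =
        (Q.map fun ω => (V l ω, W ω)).real (e.symm ⁻¹' S) := by
      rw [map_measureReal_apply (measurable_pi_lambda _ hV) hS, map_measureReal_apply hVW hS']
      congr 1
      ext ω
      have : e.symm (V l ω, W ω) = fun i => V i ω := by
        rw [MeasurableEquiv.symm_apply_eq]; rfl
      simp only [Set.mem_preimage, this]
    have e2 : (Measure.pi fun i => Q.map (V i)).real S =
        ((Q.map (V l)).prod (Measure.pi fun j => Q.map (V (l.succAbove j)))).real
          (e.symm ⁻¹' S) := by
      have := (measurePreserving_piFinSuccAbove (fun i => Q.map (V i)) l).measure_preimage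
        hS'.nullMeasurableSet
      rw [Measure.real, Measure.real, ← this]
      congr 2
      ext x
      simp only [Set.mem_preimage]
      change x ∈ S ↔ e.symm (e x) ∈ S
      simp
    have b1 := bd_rect (Q.map fun ω => (V l ω, W ω)) (Q.map (V l)) (Q.map W) (φ l) (by
      intro A B hA hB
      rw [map_measureReal_apply hVW (hA.prod hB), map_measureReal_apply (hV l) hA,
        map_measureReal_apply hW hB]
      have := h l (W ⁻¹' B) A (hWG hB) hA
      rw [mul_comm (Q.real (V l ⁻¹' A))]
      convert this using 5
      ext; simp [and_comm]) _ hS'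
    have b2 := bd_prod_right (Q.map (V l)) (Q.map W)
      (Measure.pi fun j => Q.map (V (l.succAbove j))) _ (fun S hS =>
        ih (fun j => E (l.succAbove j)) (fun j => V (l.succAbove j)) (fun j => hV _)
          (fun j => G (l.succAbove j))
          (fun i j hij => hG _ _ ((Fin.strictMono_succAbove l) hij))
          (fun j => φ (l.succAbove j)) (fun j => h _) S hS) _ hS'
    rw [e1, e2, Fin.sum_univ_succAbove φ l]
    exact (abs_sub_le _ _ _).trans (add_le_add b1 b2)

theorem bd_update {ι Ω : Type*} [Fintype ι] [DecidableEq ι] [MeasurableSpace Ω] (P : Measure Ω)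
    [IsProbabilityMeasure P] (j : ι) :
    MeasurePreserving (fun p : (ι → Ω) × Ω => Function.update p.1 j p.2)
      ((Measure.pi fun _ : ι => P).prod P) (Measure.pi fun _ : ι => P) := by
  have hm : Measurable (fun p : (ι → Ω) × Ω => Function.update p.1 j p.2) := by
    apply measurable_pi_lambda
    intro i
    by_cases hi : i = j
    · subst hi; simpa using measurable_snd
    · simpa [Function.update, hi] using! (measurable_pi_apply i).comp measurable_fst
  refine ⟨hm, (Measure.pi_eq fun s hs => ?_).symm⟩
  rw [Measure.map_apply hm (.univ_pi hs)]
  have : (fun p : (ι → Ω) × Ω => Function.update p.1 j p.2) ⁻¹' Set.univ.pi s =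
      (Set.univ.pi (Function.update s j Set.univ)) ×ˢ (s j) := by
    ext p
    simp only [Set.mem_preimage, Set.mem_pi, Set.mem_univ, true_implies, Set.mem_prod]
    constructor
    · intro h
      refine ⟨fun i => ?_, by simpa using h j⟩
      by_cases hi : i = j
      · subst hi; simp
      · simpa [Function.update, hi] using h i
    · rintro ⟨h1, h2⟩ i
      by_cases hi : i = j
      · subst hi; simpa using h2
      · simpa [Function.update, hi] using h1 i
  rw [this, Measure.prod_prod, Measure.pi_pi,
    ← Finset.mul_prod_erase _ _ (Finset.mem_univ j), ← Finset.mul_prod_erase _ (fun i => P (s i)) (Finset.mem_univ j)]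
  simp only [Function.update_self, measure_univ, one_mul]
  rw [mul_comm]
  congr 1
  apply Finset.prod_congr rfl
  intro i hi
  rw [Function.update_of_ne (Finset.ne_of_mem_erase hi)]

theorem bd_pi_mix {ι Ω : Type*} [Fintype ι] [DecidableEq ι] (G : MeasurableSpace Ω)
    [m0 : MeasurableSpace Ω] (P : Measure Ω) [IsProbabilityMeasure P] (hG : G ≤ m0) (φ : ℝ)
    (B : Set Ω) (hB : MeasurableSet B)
    (h : ∀ A, MeasurableSet[G] A → |P.real (A ∩ B) - P.real A * P.real B| ≤ φ * P.real A)
    (j : ι) (A : Set (ι → Ω)) (hA : MeasurableSet[@MeasurableSpace.pi ι (fun _ => Ω) fun _ => G] A) :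
    |(Measure.pi fun _ : ι => P).real (A ∩ (fun ω => ω j) ⁻¹' B) -
      (Measure.pi fun _ : ι => P).real A * (Measure.pi fun _ : ι => P).real ((fun ω => ω j) ⁻¹' B)|
      ≤ φ * (Measure.pi fun _ : ι => P).real A := by
  set Q := Measure.pi fun _ : ι => P with hQ
  have hA' : MeasurableSet A := by
    have : @MeasurableSpace.pi ι (fun _ => Ω) (fun _ => G) ≤ MeasurableSpace.pi :=
      iSup_mono fun i => MeasurableSpace.comap_mono hG
    exact this _ hA
  have hBm : MeasurableSet ((fun ω : ι → Ω => ω j) ⁻¹' B) := measurable_pi_apply j hB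
  have hQB : Q.real ((fun ω => ω j) ⁻¹' B) = P.real B := by
    rw [Measure.real, (measurePreserving_eval (fun _ : ι => P) j).measure_preimage
      hB.nullMeasurableSet, Measure.real]
  have hi : ∀ T : Set (ι → Ω), MeasurableSet T →
      Integrable (fun x => P.real {y | Function.update x j y ∈ T}) Q ∧
      Q.real T = ∫ x, P.real {y | Function.update x j y ∈ T} ∂Q := by
    intro T hT
    have hT' := (bd_update P j).measurable hT
    have hmm := (measurable_measure_prodMk_left (ν := P) hT')
    refine ⟨Integrable.of_bound (C := 1) ?_ (ae_of_all _ fun x => ?_), ?_⟩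
    · exact hmm.ennreal_toReal.aestronglyMeasurable
    · rw [Real.norm_of_nonneg measureReal_nonneg]
      exact measureReal_le_one
    · rw [Measure.real, ← (bd_update P j).measure_preimage hT.nullMeasurableSet,
        Measure.prod_apply hT', ← integral_toReal]
      · rfl
      · exact hmm.aemeasurable
      · exact ae_of_all _ fun x => by finiteness
  obtain ⟨i1, r1⟩ := hi _ (hA'.inter hBm)
  obtain ⟨i2, r2⟩ := hi _ hA'
  rw [hQB, r1, r2, ← integral_mul_const, ← integral_const_mul, ← integral_sub i1 (i2.mul_const _)]
  rw [← Real.norm_eq_abs]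
  refine norm_integral_le_of_norm_le (i2.const_mul _) (ae_of_all _ fun x => ?_)
  have hup : Measurable[G, @MeasurableSpace.pi ι (fun _ => Ω) fun _ => G]
      (fun y => Function.update x j y) := by
    refine @measurable_pi_lambda Ω ι (fun _ => Ω) G (fun _ => G) _ (fun i => ?_)
    by_cases hij : i = j
    · subst hij; simp only [Function.update_self]; exact @measurable_id _ G
    · simp only [Function.update, hij]
      exact @measurable_const _ _ G G _
  have := h {y | Function.update x j y ∈ A} (hup hA)
  rw [Real.norm_eq_abs]
  convert this using 5
  ext y; simp

theorem bd_phi_bdd {Ω : Type*} (G H : MeasurableSpace Ω) [m0 : MeasurableSpace Ω] (P : Measure Ω)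
    [IsProbabilityMeasure P] : ∀ x ∈ {x : ℝ | ∃ A B : Set Ω, MeasurableSet[G] A ∧
    MeasurableSet[H] B ∧ 0 < P A ∧
    x = |(P (A ∩ B)).toReal / (P A).toReal - (P B).toReal|}, x ≤ 1 := by
  rintro x ⟨A, B, -, -, -, rfl⟩
  have h1 : P.real (A ∩ B) / P.real A ≤ 1 :=
    div_le_one_of_le₀ (measureReal_mono Set.inter_subset_left) measureReal_nonneg
  have h2 : 0 ≤ P.real (A ∩ B) / P.real A := div_nonneg measureReal_nonneg measureReal_nonneg
  have h3 : P.real B ≤ 1 := measureReal_le_one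
  have h4 : 0 ≤ P.real B := measureReal_nonneg
  simp only [Measure.real] at *
  rw [abs_le]; constructor <;> linarith

theorem bd_phi_nonneg {Ω : Type*} (G H : MeasurableSpace Ω) [m0 : MeasurableSpace Ω]
    (P : Measure Ω) : 0 ≤ phiDep P G H := by
  apply Real.sSup_nonneg
  rintro x ⟨A, B, -, -, -, rfl⟩
  exact abs_nonneg _

theorem bd_phi_mix {Ω : Type*} (G H : MeasurableSpace Ω) [m0 : MeasurableSpace Ω] (P : Measure Ω)
    [IsProbabilityMeasure P] (A B : Set Ω) (hA : MeasurableSet[G] A) (hB : MeasurableSet[H] B) :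
    |P.real (A ∩ B) - P.real A * P.real B| ≤ phiDep P G H * P.real A := by
  rcases eq_or_ne (P A) 0 with h0 | h0
  · have : P (A ∩ B) = 0 := measure_mono_null Set.inter_subset_left h0
    simp [Measure.real, h0, this]
  · have hpos : 0 < P.real A := ENNReal.toReal_pos h0 (by finiteness)
    have hle : |P.real (A ∩ B) / P.real A - P.real B| ≤ phiDep P G H :=
      le_csSup ⟨1, bd_phi_bdd G H P⟩ ⟨A, B, hA, hB, pos_iff_ne_zero.2 h0, rfl⟩
    calc _ = |(P.real (A ∩ B) / P.real A - P.real B) * P.real A| := by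
          congr 1; field_simp
      _ = |P.real (A ∩ B) / P.real A - P.real B| * P.real A := by
          rw [abs_mul, abs_of_pos hpos]
      _ ≤ _ := by gcongr

set_option maxHeartbeats 2000000 in
/-- Block decorrelation estimate (Corollary 1.3.11 of [book], stated as
Proposition 4.2 in the paper).  The measure `λ` below is the joint law of the
blocks made independent, i.e. the image of the product of the block laws under
the coordinate-reassembling map. -/
theorem block_decorrelation_estimate
    {Ω : Type*} [m0 : MeasurableSpace Ω] (P : Measure Ω) [IsProbabilityMeasure P]
    (ℱ : ℤ → ℤ → MeasurableSpace Ω) (ℱlo ℱhi : ℤ → MeasurableSpace Ω)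
    (hle : ∀ a b : ℤ, ℱ a b ≤ m0) (hlole : ∀ l : ℤ, ℱlo l ≤ m0)
    (hhile : ∀ a : ℤ, ℱhi a ≤ m0)
    (hmono : ∀ a b a' b' : ℤ, a' ≤ a → b ≤ b' → ℱ a b ≤ ℱ a' b')
    (hFlo : ∀ a b : ℤ, ℱ a b ≤ ℱlo b) (hloMono : Monotone ℱlo)
    (hFhi : ∀ a b : ℤ, ℱ a b ≤ ℱhi a) (hhiAnti : Antitone ℱhi)
    (k s : ℕ) (d : ℕ → ℕ) (U : (i : ℕ) → Ω → (Fin (d i) → ℝ))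
    (m n : ℕ → ℤ)
    (hmn : ∀ i, m i ≤ n i) (hint : ∀ i j : ℕ, i < j → j < k → n i < m j)
    (hUmeas : ∀ i, i < k → Measurable[ℱ (m i) (n i)] (U i))
    -- the partition {𝒞_1,…,𝒞_s} of {1,…,k}, given by the block-assignment map c
    (c : ℕ → ℕ) (hc : ∀ i, c i < s)
    [inst : ∀ j : Fin s, SigmaFinite
      (Measure.map (fun ω => fun i : {i : Fin k // c (i : ℕ) = (j : ℕ)} => U ((i : Fin k) : ℕ) ω) P)]
    (H : ((i : Fin k) → (Fin (d (i : ℕ)) → ℝ)) → ℝ) (hHmeas : Measurable H)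
    (C : ℝ) (hC : ∀ x, |H x| ≤ C) :
    (|(∫ ω, H (fun i => U (i : ℕ) ω) ∂P) -
        ∫ x, H x ∂(Measure.map
          (fun g (i : Fin k) => g ⟨c (i : ℕ), hc (i : ℕ)⟩ ⟨i, rfl⟩)
          (Measure.pi (fun j : Fin s =>
            Measure.map (fun ω => fun i : {i : Fin k // c (i : ℕ) = (j : ℕ)} =>
              U ((i : Fin k) : ℕ) ω) P)))|
      ≤ 4 * C * ∑ i ∈ Finset.Ico 1 k,
          ⨆ j : ℤ, phiDep P (ℱlo j) (ℱhi (j + (m i - n (i - 1))))) ∧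
    (s = 2 → ∀ j₁ j₂ : Fin s, j₁ ≠ j₂ →
      alphaDep P
        (MeasurableSpace.comap
          (fun ω => fun i : {i : Fin k // c (i : ℕ) = (j₁ : ℕ)} => U ((i : Fin k) : ℕ) ω)
          inferInstance)
        (MeasurableSpace.comap
          (fun ω => fun i : {i : Fin k // c (i : ℕ) = (j₂ : ℕ)} => U ((i : Fin k) : ℕ) ω)
          inferInstance)
      ≤ 4 * ∑ i ∈ Finset.Ico 1 k,
          ⨆ j : ℤ, phiDep P (ℱlo j) (ℱhi (j + (m i - n (i - 1))))) := by
  classical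
  set Φ : ℕ → ℝ := fun i => ⨆ j : ℤ, phiDep P (ℱlo j) (ℱhi (j + (m i - n (i - 1)))) with hΦ
  have hΦ0 : ∀ i, 0 ≤ Φ i := fun i => Real.iSup_nonneg fun j => bd_phi_nonneg _ _ P
  have hsum0 : 0 ≤ ∑ i ∈ Finset.Ico 1 k, Φ i := Finset.sum_nonneg fun i _ => hΦ0 i
  let ψ : ℕ → ℝ := fun i => if i = 0 then 0 else Φ i
  have hψ : ∑ i : Fin k, ψ i = ∑ i ∈ Finset.Ico 1 k, Φ i := by
    rw [Fin.sum_univ_eq_sum_range ψ k]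
    rcases Nat.eq_zero_or_pos k with rfl | hk
    · simp
    · rw [Finset.range_eq_Ico, Finset.sum_eq_sum_Ico_succ_bot hk]
      simp only [ψ, if_true, zero_add]
      apply Finset.sum_congr rfl
      intro i hi
      have : i ≠ 0 := by have := (Finset.mem_Ico.1 hi).1; omega
      simp [this]
  let G : ℕ → MeasurableSpace Ω := fun i => if i = 0 then ⊥ else ℱlo (n (i - 1))
  have hG : ∀ i, G i ≤ m0 := by
    intro i
    by_cases hi : i = 0
    · simp [G, hi]
    · simp only [G, hi, if_false]; exact hlole _
  have hmix : ∀ i A B, MeasurableSet[G i] A → MeasurableSet[ℱhi (m i)] B →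
      |P.real (A ∩ B) - P.real A * P.real B| ≤ ψ i * P.real A := by
    intro i A B hA hB
    by_cases hi : i = 0
    · have hGi : G i = ⊥ := if_pos hi
      rw [hGi] at hA
      rcases MeasurableSpace.measurableSet_bot_iff.1 hA with rfl | rfl <;> simp [ψ, hi]
    · have hGi : G i = ℱlo (n (i - 1)) := if_neg hi
      rw [hGi] at hA
      simp only [ψ, hi, if_false]
      refine (bd_phi_mix _ _ P A B hA hB).trans ?_
      refine mul_le_mul_of_nonneg_right ?_ measureReal_nonneg
      have hb : BddAbove (Set.range fun j : ℤ =>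
          phiDep P (ℱlo j) (ℱhi (j + (m i - n (i - 1))))) := by
        refine ⟨1, ?_⟩
        rintro _ ⟨j, rfl⟩
        exact Real.sSup_le (bd_phi_bdd _ _ P) zero_le_one
      have := le_ciSup hb (n (i - 1))
      simpa using this
  have hnmono : ∀ i j, i ≤ j → j < k → n i ≤ n j := by
    intro i j hij hj
    rcases hij.eq_or_lt with rfl | hlt
    · exact le_rfl
    · exact (hint i j hlt hj).le.trans (hmn j)
  have hUm : ∀ i : Fin k, Measurable (U i) := fun i => (hUmeas i i.2).mono (hle _ _) le_rfl
  have hUhi : ∀ i : Fin k, Measurable[ℱhi (m i)] (U i) := fun i =>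
    (hUmeas i i.2).mono (hFhi _ _) le_rfl
  have hUG : ∀ i j : Fin k, j < i → Measurable[G i] (U j) := by
    intro i j hij
    have hij' : (j : ℕ) < i := hij
    have hi : (i : ℕ) ≠ 0 := by omega
    have hGi : G i = ℱlo (n (i - 1)) := if_neg hi
    rw [hGi]
    exact (hUmeas j j.2).mono ((hFlo _ _).trans
      (hloMono (hnmono _ _ (by omega) (by have := i.2; omega)))) le_rfl
  -- the original law
  have b1 := bd_chain P k (fun i => Fin (d i) → ℝ) (fun i => U i) hUm (fun i => G i) hUG
    (fun i => ψ i) (fun i A B hA hB => hmix i A _ hA (hUhi i hB))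
  -- the law with independent blocks
  let Q : Measure (Fin s → Ω) := Measure.pi fun _ => P
  let V : (i : Fin k) → (Fin s → Ω) → (Fin (d i) → ℝ) := fun i ω => U i (ω ⟨c i, hc i⟩)
  have hV : ∀ i, Measurable (V i) := fun i => (hUm i).comp (measurable_pi_apply _)
  have hVpre : ∀ (i : Fin k) (B : Set (Fin (d i) → ℝ)),
      V i ⁻¹' B = (fun ω : Fin s → Ω => ω ⟨c i, hc i⟩) ⁻¹' (U i ⁻¹' B) := fun i B => rfl
  have hVmix : ∀ (i : Fin k) (A : Set (Fin s → Ω)) (B : Set (Fin (d i) → ℝ)),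
      MeasurableSet[@MeasurableSpace.pi (Fin s) (fun _ => Ω) fun _ => G i] A → MeasurableSet B →
      |Q.real (A ∩ V i ⁻¹' B) - Q.real A * Q.real (V i ⁻¹' B)| ≤ ψ i * Q.real A := by
    intro i A B hA hB
    rw [hVpre]
    exact bd_pi_mix (G i) P (hG i) (ψ i) (U i ⁻¹' B) (hUm i hB)
      (fun A' hA' => hmix i A' _ hA' (hUhi i hB)) (⟨c i, hc i⟩ : Fin s) A hA
  have b2 := bd_chain Q k (fun i => Fin (d i) → ℝ) V hV
    (fun i => @MeasurableSpace.pi (Fin s) (fun _ => Ω) fun _ => G i)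
    (fun i j hij => (hUG i j hij).comp
      (@measurable_pi_apply (Fin s) (fun _ => Ω) (fun _ => G i) _))
    (fun i => ψ i) hVmix
  have hQV : ∀ i, Q.map (V i) = P.map (U i) := by
    intro i
    have := (measurePreserving_eval (fun _ : Fin s => P) ⟨c i, hc i⟩).map_eq
    rw [← this, Measure.map_map (hUm i) (measurable_pi_apply _)]
    rfl
  simp only [hQV] at b2
  rw [hψ] at b1 b2
  set blk : (j : Fin s) → Ω → ((i : {i : Fin k // c (i : ℕ) = (j : ℕ)}) →
    (Fin (d ((i : Fin k) : ℕ)) → ℝ)) := fun j ω i => U ((i : Fin k) : ℕ) ω with hblk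
  have hblkm : ∀ j, Measurable (blk j) := fun j => measurable_pi_lambda _ fun i => hUm i
  have hlam : Measure.map (fun (g : (j : Fin s) → ((i : {i : Fin k // c (i : ℕ) = (j : ℕ)}) →
        (Fin (d ((i : Fin k) : ℕ)) → ℝ))) (i : Fin k) => g ⟨c (i : ℕ), hc (i : ℕ)⟩ ⟨i, rfl⟩)
      (Measure.pi (fun j : Fin s => Measure.map (blk j) P)) = Q.map (fun ω i => V i ω) := by
    rw [← Measure.pi_map_pi (fun j => (hblkm j).aemeasurable), Measure.map_map]
    · rfl
    · refine measurable_pi_lambda _ fun i => ?_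
      exact (measurable_pi_apply _).comp (measurable_pi_apply _)
    · exact measurable_pi_lambda _ fun j => (hblkm j).comp (measurable_pi_apply j)
  have hUU : Measurable (fun ω (i : Fin k) => U i ω) := measurable_pi_lambda _ hUm
  have hVV : Measurable (fun ω (i : Fin k) => V i ω) := measurable_pi_lambda _ hV
  have hset : ∀ S, MeasurableSet S →
      |(P.map (fun ω (i : Fin k) => U i ω)).real S - (Q.map (fun ω (i : Fin k) => V i ω)).real S|
        ≤ 2 * ∑ i ∈ Finset.Ico 1 k, Φ i := by
    intro S hS
    have h1 := abs_le.1 (b1 S hS)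
    have h2 := abs_le.1 (b2 S hS)
    rw [abs_le]
    constructor <;> linarith
  have i1 : IsProbabilityMeasure (P.map (fun ω (i : Fin k) => U i ω)) :=
    Measure.isProbabilityMeasure_map hUU.aemeasurable
  have i2 : IsProbabilityMeasure (Q.map (fun ω (i : Fin k) => V i ω)) :=
    Measure.isProbabilityMeasure_map hVV.aemeasurable
  constructor
  · rw [hlam, ← integral_map (f := H) hUU.aemeasurable hHmeas.aestronglyMeasurable]
    refine (bd_integral _ _ _ C ((abs_nonneg _).trans (hC fun _ _ => 0)) hset H hHmeas hC).trans ?_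
    apply le_of_eq; ring
  · intro hs j₁ j₂ hne
    apply Real.sSup_le _ (by positivity)
    rintro x ⟨_, _, ⟨A, hA, rfl⟩, ⟨B, hB, rfl⟩, rfl⟩
    let T : Set ((i : Fin k) → (Fin (d (i : ℕ)) → ℝ)) :=
      {x | (fun i : {i : Fin k // c (i : ℕ) = (j₁ : ℕ)} => x i) ∈ A ∧
        (fun i : {i : Fin k // c (i : ℕ) = (j₂ : ℕ)} => x i) ∈ B}
    have hT : MeasurableSet T := by
      have hr : ∀ j : Fin s, Measurable (fun (x : (i : Fin k) → (Fin (d (i : ℕ)) → ℝ))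
          (i : {i : Fin k // c (i : ℕ) = (j : ℕ)}) => x i) := fun j =>
        measurable_pi_lambda _ fun i => measurable_pi_apply (i : Fin k)
      exact (hr j₁ hA).inter (hr j₂ hB)
    have h := hset T hT
    rw [map_measureReal_apply hUU hT, map_measureReal_apply hVV hT] at h
    have t1 : (fun ω (i : Fin k) => U i ω) ⁻¹' T = blk j₁ ⁻¹' A ∩ blk j₂ ⁻¹' B := rfl
    have t2 : (fun ω (i : Fin k) => V i ω) ⁻¹' T =
        (fun ω => ω j₁) ⁻¹' (blk j₁ ⁻¹' A) ∩ (fun ω => ω j₂) ⁻¹' (blk j₂ ⁻¹' B) := by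
      have e : ∀ (j : Fin s) (ω : Fin s → Ω),
          (fun i : {i : Fin k // c (i : ℕ) = (j : ℕ)} => V i ω) = blk j (ω j) := by
        intro j ω
        funext i
        have : (⟨c (i : Fin k), hc _⟩ : Fin s) = j := Fin.ext i.2
        simp only [V, hblk, this]
      ext ω
      simp only [T, Set.mem_preimage, Set.mem_ofPred_eq, Set.mem_inter_iff, e]
    have t3 : Q.real ((fun ω => ω j₁) ⁻¹' (blk j₁ ⁻¹' A) ∩ (fun ω => ω j₂) ⁻¹' (blk j₂ ⁻¹' B)) =
        P.real (blk j₁ ⁻¹' A) * P.real (blk j₂ ⁻¹' B) := by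
      have hind := ProbabilityTheory.iIndepFun_pi (μ := fun _ : Fin s => P) (X := fun _ x => x)
        (fun _ => aemeasurable_id)
      have := (hind.indepFun hne).measure_inter_preimage_eq_mul _ _ (hblkm j₁ hA) (hblkm j₂ hB)
      have ev : ∀ (j : Fin s) (D : Set Ω), MeasurableSet D →
          Q ((fun ω => ω j) ⁻¹' D) = P D := fun j D hD =>
        (measurePreserving_eval (fun _ : Fin s => P) j).measure_preimage hD.nullMeasurableSet
      rw [Measure.real]
      erw [this]
      rw [ENNReal.toReal_mul]
      erw [ev _ _ (hblkm j₁ hA), ev _ _ (hblkm j₂ hB)]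
      rfl
    rw [t1, t2, t3] at h
    exact h.trans (by linarith)
end
end

section
/- Product approximation of expectations under φ-mixing: Let U_1,…,U_k be random vectors, U_i being ℝ^{d_i}-valued and ℱ_{m_i,n_i}-measurable with law ν_i, where n_{i−1} < m_i ≤ n_i < m_{i+1} for i = 1,…,k, n_0 = −∞, m_{k+1} = ∞. Then for every bounded Borel function H : ℝ^{d_1+…+d_k} → ℝ: |E[H(U_1,…,U_k)] − ∫ H(u_1,…,u_k) dν_1(u_1)⋯dν_k(u_k)| ≤ 2·(sup|H|)·Σ_{i=2}^k φ(m_i − n_{i−1}). -/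
open MeasureTheory
open scoped ENNReal

noncomputable section

/-- Sets of the form `{(x, y) | y ∈ f x}` with `f` a simple function valued in measurable sets. -/
def stairs (E F : Type*) [MeasurableSpace E] [MeasurableSpace F] : Set (Set (E × F)) :=
  {S | ∃ f : SimpleFunc E (Set F), (∀ x, MeasurableSet (f x)) ∧ S = {p | p.2 ∈ f p.1}}

lemma stairs_eq {E F : Type*} [MeasurableSpace E] (f : SimpleFunc E (Set F)) :
    {p : E × F | p.2 ∈ f p.1} = ⋃ B ∈ f.range, (f ⁻¹' {B}) ×ˢ B := by
  ext ⟨x, y⟩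
  simp only [Set.mem_ofPred_eq, Set.mem_iUnion, Set.mem_prod, Set.mem_preimage,
    Set.mem_singleton_iff]
  constructor
  · intro h
    exact ⟨f x, SimpleFunc.mem_range_self f x, rfl, h⟩
  · rintro ⟨B, _, h1, h2⟩
    rwa [h1]

lemma stairs_disj {E F : Type*} [MeasurableSpace E] (f : SimpleFunc E (Set F)) :
    Set.PairwiseDisjoint (f.range : Set (Set F)) (fun B => (f ⁻¹' {B}) ×ˢ B) := by
  intro B _ B' _ hne
  rw [Function.onFun, Set.disjoint_left]
  rintro ⟨x, y⟩ h1 h2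
  simp only [Set.mem_prod, Set.mem_preimage, Set.mem_singleton_iff] at h1 h2
  exact hne (h1.1.symm.trans h2.1)

lemma stairs_meas {E F : Type*} [MeasurableSpace E] [MeasurableSpace F]
    (f : SimpleFunc E (Set F)) (hf : ∀ x, MeasurableSet (f x)) :
    ∀ B ∈ f.range, MeasurableSet ((f ⁻¹' {B}) ×ˢ B) := by
  intro B hB
  obtain ⟨x, rfl⟩ := SimpleFunc.mem_range.1 hB
  exact (f.measurableSet_fiber _).prod (hf x)

lemma stairs_algebra (E F : Type*) [MeasurableSpace E] [MeasurableSpace F] :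
    IsSetAlgebra (stairs E F) where
  empty_mem := ⟨SimpleFunc.const _ ∅, by simp, by simp⟩
  compl_mem := by
    rintro s ⟨f, hf, rfl⟩
    exact ⟨f.map compl, fun x => (hf x).compl, by ext; simp⟩
  union_mem := by
    rintro s t ⟨f, hf, rfl⟩ ⟨g, hg, rfl⟩
    exact ⟨(f.pair g).map (fun q : Set F × Set F => q.1 ∪ q.2), fun x => (hf x).union (hg x), by ext; simp⟩

lemma stairs_gen (E F : Type*) [MeasurableSpace E] [MeasurableSpace F] :
    (Prod.instMeasurableSpace : MeasurableSpace (E × F)) =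
      MeasurableSpace.generateFrom (stairs E F) := by
  apply le_antisymm
  · rw [← generateFrom_prod]
    apply MeasurableSpace.generateFrom_mono
    rintro _ ⟨A, hA, B, hB, rfl⟩
    classical
    refine ⟨SimpleFunc.piecewise A hA (SimpleFunc.const _ B) (SimpleFunc.const _ ∅), ?_, ?_⟩
    · intro x
      by_cases hx : x ∈ A
      · simpa [hx] using hB
      · simp [hx]
    · ext ⟨x, y⟩
      by_cases hx : x ∈ A <;> simp [hx]
  · apply MeasurableSpace.generateFrom_le
    rintro _ ⟨f, hf, rfl⟩
    rw [stairs_eq]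
    exact Finset.measurableSet_biUnion _ (stairs_meas f hf)

lemma set_bound {E F : Type*} [MeasurableSpace E] [MeasurableSpace F]
    (ρ : Measure (E × F)) (μ : Measure E) (ν : Measure F)
    [IsProbabilityMeasure ρ] [IsProbabilityMeasure μ] [IsProbabilityMeasure ν] (φ : ℝ)
    (h : ∀ A B, MeasurableSet A → MeasurableSet B →
      |ρ.real (A ×ˢ B) - μ.real A * ν.real B| ≤ φ * μ.real A)
    (S : Set (E × F)) (hS : MeasurableSet S) :
    |ρ.real S - (μ.prod ν).real S| ≤ φ := by
  have key : ∀ T ∈ stairs E F, |ρ.real T - (μ.prod ν).real T| ≤ φ := by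
    rintro _ ⟨f, hf, rfl⟩
    rw [stairs_eq, measureReal_biUnion_finset (stairs_disj f) (stairs_meas f hf),
      measureReal_biUnion_finset (stairs_disj f) (stairs_meas f hf), ← Finset.sum_sub_distrib]
    refine (Finset.abs_sum_le_sum_abs _ _).trans ?_
    calc _ ≤ ∑ B ∈ f.range, φ * μ.real (f ⁻¹' {B}) := by
          refine Finset.sum_le_sum fun B hB => ?_
          obtain ⟨x, rfl⟩ := SimpleFunc.mem_range.1 hB
          rw [measureReal_prod_prod]
          exact h _ _ (f.measurableSet_fiber _) (hf x)
      _ = φ := by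
          rw [← Finset.mul_sum]
          have : ∑ B ∈ f.range, μ.real (f ⁻¹' {B}) = μ.real Set.univ := by
            have hd : Set.PairwiseDisjoint (f.range : Set (Set F)) (fun B => f ⁻¹' {B}) := by
              intro B _ B' _ hne
              exact (Set.disjoint_singleton.2 hne).preimage _
            rw [← measureReal_biUnion_finset hd (fun B _ => f.measurableSet_fiber B)]
            congr 1
            ext x
            simp
          rw [this]
          simp
  refine le_of_forall_pos_le_add fun ε hε => ?_
  obtain ⟨T, hT, hTε⟩ := (Measure.MeasureDense.of_generateFrom_isSetAlgebra_finite
    (ρ + μ.prod ν) (stairs_algebra E F) (stairs_gen E F)).approx S hS (by finiteness) ε hε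
  have hTm : MeasurableSet T := by
    rw [stairs_gen E F]
    exact MeasurableSpace.measurableSet_generateFrom hT
  have e1 := abs_measureReal_sub_le_measureReal_symmDiff (μ := ρ)
    hS.nullMeasurableSet hTm.nullMeasurableSet
  have e2 := abs_measureReal_sub_le_measureReal_symmDiff (μ := μ.prod ν)
    hS.nullMeasurableSet hTm.nullMeasurableSet
  have e3 : ρ.real (symmDiff S T) + (μ.prod ν).real (symmDiff S T) < ε := by
    rw [← measureReal_add_apply]
    exact (ENNReal.lt_ofReal_iff_toReal_lt (by finiteness)).1 hTε
  have e4 := key T hT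
  rw [abs_le] at *
  constructor <;> linarith [e1.1, e1.2, e2.1, e2.2, e4.1, e4.2]

lemma int_bound {E : Type*} [MeasurableSpace E] (ρ π : Measure E)
    [IsProbabilityMeasure ρ] [IsProbabilityMeasure π] (φ : ℝ)
    (h : ∀ S, MeasurableSet S → |ρ.real S - π.real S| ≤ φ)
    (g : E → ℝ) (hg : Measurable g) (C : ℝ) (hC : ∀ x, |g x| ≤ C) :
    |∫ x, g x ∂ρ - ∫ x, g x ∂π| ≤ 2 * C * φ := by
  have hE : Nonempty E := ρ.nonempty_of_neZero
  have hC0 : 0 ≤ C := (abs_nonneg _).trans (hC hE.some)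
  have hb : ∀ x, 0 ≤ g x + C ∧ g x + C ≤ 2 * C := fun x => by
    have := abs_le.1 (hC x)
    constructor <;> linarith
  have hi : ∀ (κ : Measure E) [IsProbabilityMeasure κ], Integrable g κ := fun κ _ =>
    Integrable.of_bound hg.aestronglyMeasurable C (Filter.Eventually.of_forall hC)
  have hl : ∀ (κ : Measure E) [IsProbabilityMeasure κ],
      ∫ x, g x ∂κ = (∫ t in Set.Ioc 0 (2 * C), κ.real {a | t ≤ g a + C}) - C := fun κ _ => by
    rw [← Integrable.integral_eq_integral_Ioc_meas_le (f := fun x => g x + C) (M := 2 * C)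
      ((hi κ).add (integrable_const C)) (Filter.Eventually.of_forall fun x => (hb x).1)
      (Filter.Eventually.of_forall fun x => (hb x).2), integral_add (hi κ) (integrable_const C)]
    simp
  have hm : ∀ (κ : Measure E) [IsProbabilityMeasure κ],
      IntegrableOn (fun t => κ.real {a | t ≤ g a + C}) (Set.Ioc 0 (2 * C)) := fun κ _ => by
    have ha : Antitone (fun t : ℝ => κ.real {a | t ≤ g a + C}) := fun s t hst =>
      measureReal_mono (fun a ha => le_trans hst ha)
    exact Integrable.of_bound ha.measurable.aestronglyMeasurable 1
      (Filter.Eventually.of_forall fun t => by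
        rw [Real.norm_of_nonneg measureReal_nonneg]; exact measureReal_le_one)
  rw [hl ρ, hl π, sub_sub_sub_cancel_right, ← integral_sub (hm ρ) (hm π)]
  have := norm_setIntegral_le_of_norm_le_const (μ := volume) (s := Set.Ioc 0 (2 * C)) (C := φ)
    (f := fun t => ρ.real {a | t ≤ g a + C} - π.real {a | t ≤ g a + C})
    measure_Ioc_lt_top
    (fun t _ => h _ (measurableSet_le measurable_const (hg.add_const C)))
  rw [Real.norm_eq_abs] at this
  refine this.trans (le_of_eq ?_)
  rw [Real.volume_real_Ioc_of_le (by linarith)]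
  ring

lemma pair_bound {Ω E F : Type*} [MeasurableSpace Ω] [MeasurableSpace E] [MeasurableSpace F]
    (P : Measure Ω) [IsProbabilityMeasure P] (X : Ω → E) (Y : Ω → F)
    (hX : Measurable X) (hY : Measurable Y) (φ : ℝ)
    (h : ∀ A B, MeasurableSet A → MeasurableSet B →
      |P.real (X ⁻¹' A ∩ Y ⁻¹' B) - P.real (X ⁻¹' A) * P.real (Y ⁻¹' B)| ≤ φ * P.real (X ⁻¹' A))
    (g : E × F → ℝ) (hg : Measurable g) (C : ℝ) (hC : ∀ x, |g x| ≤ C) :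
    |∫ ω, g (X ω, Y ω) ∂P - ∫ ω, ∫ x, g (x, Y ω) ∂(P.map X) ∂P| ≤ 2 * C * φ := by
  have := Measure.isProbabilityMeasure_map (μ := P) hX.aemeasurable
  have := Measure.isProbabilityMeasure_map (μ := P) hY.aemeasurable
  have := Measure.isProbabilityMeasure_map (μ := P) (hX.prodMk hY).aemeasurable
  have hs := set_bound (P.map (fun ω => (X ω, Y ω))) (P.map X) (P.map Y) φ (by
    intro A B hA hB
    rw [map_measureReal_apply (hX.prodMk hY) (hA.prod hB), map_measureReal_apply hX hA,
      map_measureReal_apply hY hB]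
    exact h A B hA hB)
  have := int_bound _ _ φ hs g hg C hC
  rw [integral_map (hX.prodMk hY).aemeasurable hg.aestronglyMeasurable,
    integral_prod_symm _ (Integrable.of_bound hg.aestronglyMeasurable C
      (Filter.Eventually.of_forall hC)),
    integral_map hY.aemeasurable] at this
  · exact this
  · exact (hg.stronglyMeasurable.integral_prod_left').aestronglyMeasurable

lemma measurable_cons' (k : ℕ) (α : ℕ → Type*) [∀ i, MeasurableSpace (α i)] :
    Measurable (fun q : α 0 × (∀ i : Fin k, α ((i : ℕ) + 1)) =>
      (Fin.cons (α := fun i : Fin (k + 1) => α (i : ℕ)) q.1 q.2 : ∀ i : Fin (k + 1), α (i : ℕ))) := by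
  refine measurable_pi_iff.2 fun i => ?_
  refine Fin.cases ?_ (fun j => ?_) i
  · exact measurable_fst
  · exact (measurable_pi_apply j).comp measurable_snd

lemma map_pi_cons (k : ℕ) (α : ℕ → Type*) [∀ i, MeasurableSpace (α i)]
    (μ : ∀ i, Measure (α i)) (hμ : ∀ i, i < k + 1 → IsProbabilityMeasure (μ i)) :
    ((μ 0).prod (Measure.pi fun i : Fin k => μ ((i : ℕ) + 1))).map (fun q =>
      (Fin.cons (α := fun i : Fin (k + 1) => α (i : ℕ)) q.1 q.2 : ∀ i : Fin (k + 1), α (i : ℕ)))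
      = Measure.pi fun i : Fin (k + 1) => μ (i : ℕ) := by
  have h0 := hμ 0 (by omega)
  have h1 : ∀ i : Fin (k + 1), IsProbabilityMeasure (μ (i : ℕ)) := fun i => hμ _ i.2
  have h2 : ∀ i : Fin k, IsProbabilityMeasure (μ ((i : ℕ) + 1)) := fun i => hμ _ (by omega)
  symm
  refine Measure.pi_eq fun s hs => ?_
  rw [Measure.map_apply (measurable_cons' k α) (MeasurableSet.univ_pi hs)]
  let s0 : Set (α 0) := s 0
  let st : ∀ i : Fin k, Set (α ((i : ℕ) + 1)) := fun i => s i.succ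
  have : (fun q : α 0 × (∀ i : Fin k, α ((i : ℕ) + 1)) =>
      (Fin.cons (α := fun i : Fin (k + 1) => α (i : ℕ)) q.1 q.2 : ∀ i : Fin (k + 1), α (i : ℕ)))
      ⁻¹' (Set.univ.pi s) = s0 ×ˢ (Set.univ.pi st) := by
    ext ⟨x, y⟩
    simp only [Set.mem_preimage, Set.mem_pi, Set.mem_univ, true_imp_iff, Set.mem_prod]
    constructor
    · intro h
      exact ⟨h 0, fun i => h i.succ⟩
    · rintro ⟨h, h'⟩ i
      exact Fin.cases h h' i
  rw [this, Measure.prod_prod, Measure.pi_pi, Fin.prod_univ_succ]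
  rfl

lemma integral_pi_cons (k : ℕ) (α : ℕ → Type*) [∀ i, MeasurableSpace (α i)]
    (μ : ∀ i, Measure (α i)) (hμ : ∀ i, i < k + 1 → IsProbabilityMeasure (μ i))
    (g : (∀ i : Fin (k + 1), α (i : ℕ)) → ℝ) (hg : Measurable g) (C : ℝ) (hC : ∀ x, |g x| ≤ C) :
    ∫ x, g x ∂(Measure.pi fun i : Fin (k + 1) => μ (i : ℕ)) =
      ∫ y, ∫ x, g (Fin.cons (α := fun i : Fin (k + 1) => α (i : ℕ)) x y) ∂(μ 0)
        ∂(Measure.pi fun i : Fin k => μ ((i : ℕ) + 1)) := by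
  have h0 := hμ 0 (by omega)
  have h2 : ∀ i : Fin k, IsProbabilityMeasure (μ ((i : ℕ) + 1)) := fun i => hμ _ (by omega)
  rw [← map_pi_cons k α μ hμ, integral_map (measurable_cons' k α).aemeasurable
    hg.aestronglyMeasurable]
  exact integral_prod_symm _ (Integrable.of_bound
    (hg.comp (measurable_cons' k α)).aestronglyMeasurable C
      (Filter.Eventually.of_forall fun _ => hC _))

lemma chain_bound {Ω : Type*} [m0 : MeasurableSpace Ω] (P : Measure Ω) [IsProbabilityMeasure P]
    (k : ℕ) : ∀ (α : ℕ → Type) [∀ i, MeasurableSpace (α i)] (U : ∀ i, Ω → α i)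
    (G K : ℕ → MeasurableSpace Ω) (φ : ℕ → ℝ)
    (_ : ∀ i, i < k → Measurable (U i))
    (_ : ∀ i, i + 1 < k → Measurable[G i] (U i))
    (_ : ∀ i j, i < j → j < k → Measurable[K i] (U j))
    (_ : ∀ i, i + 1 < k → ∀ A B, MeasurableSet[G i] A → MeasurableSet[K i] B →
      |P.real (A ∩ B) - P.real A * P.real B| ≤ φ i * P.real A)
    (H : (∀ i : Fin k, α (i : ℕ)) → ℝ) (_ : Measurable H) (C : ℝ) (_ : ∀ x, |H x| ≤ C),
    |(∫ ω, H (fun i => U (i : ℕ) ω) ∂P) -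
        ∫ x, H x ∂(Measure.pi (fun i : Fin k => Measure.map (U (i : ℕ)) P))|
      ≤ 2 * C * ∑ i ∈ Finset.range (k - 1), φ i := by
  induction k with
  | zero =>
    intro α _ U G K φ _ _ _ _ H hH C hC
    have this0 : ∀ x, H x = H (fun i => i.elim0) := fun x => congrArg H (Subsingleton.elim _ _)
    have : ∀ i : Fin 0, IsProbabilityMeasure (P.map (U (i : ℕ))) := fun i => i.elim0
    simp [this, this0]
  | succ k ih =>
    intro α _ U G K φ hU hG hK hdep H hH C hC
    have hp : ∀ i, i < k + 1 → IsProbabilityMeasure (P.map (U i)) := fun i hi =>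
      Measure.isProbabilityMeasure_map (hU i hi).aemeasurable
    have h0 := hp 0 (by omega)
    rw [integral_pi_cons k α (fun i => P.map (U i)) hp H hH C hC]
    have hHm := hH.comp (measurable_cons' k α)
    have hY : Measurable fun ω => (fun i : Fin k => U ((i : ℕ) + 1) ω) :=
      measurable_pi_iff.2 fun i => hU _ (by omega)
    have step := ih (fun i => α (i + 1)) (fun i => U (i + 1)) (fun i => G (i + 1))
      (fun i => K (i + 1)) (fun i => φ (i + 1)) (fun i hi => hU _ (by omega))
      (fun i hi => hG _ (by omega)) (fun i j hij hj => hK _ _ (by omega) (by omega))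
      (fun i hi => hdep _ (by omega))
      (fun y => ∫ x, H (Fin.cons (α := fun i : Fin (k + 1) => α (i : ℕ)) x y) ∂(P.map (U 0)))
      (hHm.stronglyMeasurable.integral_prod_left').measurable C (fun y => by
        have := norm_integral_le_of_norm_le_const (μ := P.map (U 0))
          (f := fun x => H (Fin.cons (α := fun i : Fin (k + 1) => α (i : ℕ)) x y)) (C := C)
          (Filter.Eventually.of_forall fun x => hC _)
        simpa using this)
    have first := pair_bound P (U 0) (fun ω => (fun i : Fin k => U ((i : ℕ) + 1) ω))
      (hU 0 (by omega)) hY (if k = 0 then 0 else φ 0) (by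
        intro A B hA hB
        split_ifs with hk
        · subst hk
          have hBs : B = ∅ ∨ B = Set.univ := Set.eq_empty_or_nonempty B |>.imp id
            (fun hne => Subsingleton.eq_univ_of_nonempty hne)
          rcases hBs with rfl | rfl <;> simp
        · refine hdep 0 (by omega) _ _ (hG 0 (by omega) hA) ?_
          have : Measurable[K 0] fun ω => (fun i : Fin k => U ((i : ℕ) + 1) ω) :=
            @measurable_pi_iff _ _ _ (K 0) _ _ |>.2 fun i => hK 0 _ (by omega) (by omega)
          exact this hB) _ hHm C (fun x => hC _)
    have hsum : ∑ i ∈ Finset.range (k + 1 - 1), φ i =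
        (if k = 0 then 0 else φ 0) + ∑ i ∈ Finset.range (k - 1), φ (i + 1) +
        (if k = 0 then 0 else 0) := by
      rcases k with _ | k
      · simp
      · simp [Finset.sum_range_succ', add_comm]
    have hcons : ∀ ω, (Fin.cons (α := fun i : Fin (k + 1) => α (i : ℕ)) (U 0 ω)
        (fun i : Fin k => U ((i : ℕ) + 1) ω)) = (fun i : Fin (k + 1) => U (i : ℕ) ω) := by
      intro ω
      funext i
      exact Fin.cases rfl (fun _ => rfl) i
    simp only [Function.comp_def, hcons] at first
    rw [hsum, ite_self, add_zero, mul_add]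
    exact (abs_sub_le _ _ _).trans (add_le_add first step)

lemma phiDep_bdd {Ω : Type*} (G K : MeasurableSpace Ω) [m0 : MeasurableSpace Ω]
    (P : Measure Ω) [IsProbabilityMeasure P] (x : ℝ)
    (hx : x ∈ {x : ℝ | ∃ A B : Set Ω, MeasurableSet[G] A ∧ MeasurableSet[K] B ∧ 0 < P A ∧
      x = |(P (A ∩ B)).toReal / (P A).toReal - (P B).toReal|}) : x ≤ 1 := by
  obtain ⟨A, B, -, -, hA, rfl⟩ := hx
  have h1 : P.real (A ∩ B) / P.real A ≤ 1 :=
    div_le_one_of_le₀ (measureReal_mono Set.inter_subset_left) measureReal_nonneg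
  have h2 : 0 ≤ P.real (A ∩ B) / P.real A := div_nonneg measureReal_nonneg measureReal_nonneg
  have h3 : P.real B ≤ 1 := measureReal_le_one
  have h4 : 0 ≤ P.real B := measureReal_nonneg
  change |P.real (A ∩ B) / P.real A - P.real B| ≤ 1
  rw [abs_le]
  constructor <;> linarith

lemma phiDep_spec {Ω : Type*} (G K : MeasurableSpace Ω) [m0 : MeasurableSpace Ω]
    (P : Measure Ω) [IsProbabilityMeasure P] (A B : Set Ω) (hA : MeasurableSet[G] A) (hB : MeasurableSet[K] B) :
    |P.real (A ∩ B) - P.real A * P.real B| ≤ phiDep P G K * P.real A := by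
  rcases eq_or_ne (P A) 0 with h | h
  · have h1 : P.real A = 0 := by simp [Measure.real, h]
    have h2 : P.real (A ∩ B) = 0 :=
      le_antisymm (h1 ▸ measureReal_mono Set.inter_subset_left) measureReal_nonneg
    simp [h1, h2]
  · have hpos : 0 < P.real A := ENNReal.toReal_pos h (by finiteness)
    have := le_csSup ⟨1, fun x hx => phiDep_bdd G K P x hx⟩
      ⟨A, B, hA, hB, pos_iff_ne_zero.2 h, rfl⟩
    change |P.real (A ∩ B) / P.real A - P.real B| ≤ phiDep P G K at this
    calc _ = |P.real (A ∩ B) / P.real A - P.real B| * P.real A := by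
          rw [← abs_of_pos hpos, ← abs_mul, abs_of_pos hpos, sub_mul, div_mul_cancel₀ _ hpos.ne',
            mul_comm (P.real B)]
      _ ≤ _ := by gcongr

/-- Product approximation of expectations under φ-mixing
(Corollary 1.3.11 of [book], stated as Proposition 4.2 in the paper): the
expectation of `H(U₁,…,U_k)` is within `2·sup|H|·Σ_{i=2}^k φ(m_i − n_{i−1})` of the
integral of `H` against the product of the marginal laws. -/
theorem product_approximation_phi_mixing
    {Ω : Type*} [m0 : MeasurableSpace Ω] (P : Measure Ω) [IsProbabilityMeasure P]
    (ℱ : ℤ → ℤ → MeasurableSpace Ω) (ℱlo ℱhi : ℤ → MeasurableSpace Ω)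
    (hle : ∀ a b : ℤ, ℱ a b ≤ m0) (hlole : ∀ l : ℤ, ℱlo l ≤ m0)
    (hhile : ∀ a : ℤ, ℱhi a ≤ m0)
    (hmono : ∀ a b a' b' : ℤ, a' ≤ a → b ≤ b' → ℱ a b ≤ ℱ a' b')
    (hFlo : ∀ a b : ℤ, ℱ a b ≤ ℱlo b) (hloMono : Monotone ℱlo)
    (hFhi : ∀ a b : ℤ, ℱ a b ≤ ℱhi a) (hhiAnti : Antitone ℱhi)
    (k : ℕ) (d : ℕ → ℕ) (U : (i : ℕ) → Ω → (Fin (d i) → ℝ))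
    (m n : ℕ → ℤ)
    (hmn : ∀ i, m i ≤ n i) (hint : ∀ i j : ℕ, i < j → j < k → n i < m j)
    (hUmeas : ∀ i, i < k → Measurable[ℱ (m i) (n i)] (U i))
    [inst : ∀ i : Fin k, SigmaFinite (Measure.map (U (i : ℕ)) P)]
    (H : ((i : Fin k) → (Fin (d (i : ℕ)) → ℝ)) → ℝ) (hHmeas : Measurable H)
    (C : ℝ) (hC : ∀ x, |H x| ≤ C) :
    |(∫ ω, H (fun i => U (i : ℕ) ω) ∂P) -
        ∫ x, H x ∂(Measure.pi (fun i : Fin k => Measure.map (U (i : ℕ)) P))|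
      ≤ 2 * C * ∑ i ∈ Finset.Ico 1 k,
          ⨆ j : ℤ, phiDep P (ℱlo j) (ℱhi (j + (m i - n (i - 1)))) := by
  have hsum : ∑ i ∈ Finset.Ico 1 k,
      (⨆ j : ℤ, phiDep P (ℱlo j) (ℱhi (j + (m i - n (i - 1))))) =
      ∑ i ∈ Finset.range (k - 1), ⨆ j : ℤ, phiDep P (ℱlo j) (ℱhi (j + (m (i + 1) - n i))) := by
    rw [Finset.sum_Ico_eq_sum_range]
    refine Finset.sum_congr rfl fun i _ => ?_
    rw [add_comm 1 i, Nat.add_sub_cancel]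
  rw [hsum]
  refine chain_bound P k (fun i => Fin (d i) → ℝ) U (fun i => ℱlo (n i))
    (fun i => ℱhi (m (i + 1))) _ (fun i hi => (hUmeas i hi).mono (hle _ _) le_rfl)
    (fun i hi => (hUmeas i (by omega)).mono (hFlo _ _) le_rfl) ?_ ?_ H hHmeas C hC
  · intro i j hij hj
    refine (hUmeas j hj).mono ((hFhi _ _).trans (hhiAnti ?_)) le_rfl
    rcases eq_or_lt_of_le (Nat.succ_le_of_lt hij) with h | h
    · exact le_of_eq (congrArg m h)
    · exact ((hmn (i + 1)).trans (hint (i + 1) j h hj).le)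
  · intro i hi A B hA hB
    refine (phiDep_spec _ _ P A B hA hB).trans ?_
    refine mul_le_mul_of_nonneg_right ?_ measureReal_nonneg
    have hb : BddAbove (Set.range fun j : ℤ =>
        phiDep P (ℱlo j) (ℱhi (j + (m (i + 1) - n i)))) := by
      refine ⟨1, ?_⟩
      rintro _ ⟨j, rfl⟩
      exact Real.sSup_le (fun x hx => phiDep_bdd _ _ P x hx) zero_le_one
    have := le_ciSup hb (n i)
    simpa using this
end
end
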